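/- Let u ∈ A₁ be a weight on ℝⁿ. Then there is a dimensional constant c_n such that for every f ∈ L¹(u²): ‖M(fu)/u‖_{L^{1,∞}(u²)} ≤ c_n [u]_{A₁}² ‖f‖_{L¹(u²)}; that is, sup_{t>0} t · ∫_{{x : M(fu)(x) > t u(x)}} u(x)² dx ≤ c_n [u]_{A₁}² ∫_{ℝⁿ} |f| u² dx. -/

import Mathlib

open MeasureTheory ENNReal NNReal

noncomputable section

/-- An axis-parallel cube in `ℝⁿ`. -/
def IsCube {n : ℕ} (Q : Set (Fin n → ℝ)) : Prop :=
  ∃ (a : Fin n → ℝ) (h : ℝ), 0 < h ∧ Q = {x | ∀ i, a i ≤ x i ∧ x i ≤ a i + h}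

/-- Average `(1/|Q|) ∫_Q f` of an `ℝ≥0∞`-valued function over a set. -/
def cubeAvg {n : ℕ} (f : (Fin n → ℝ) → ℝ≥0∞) (Q : Set (Fin n → ℝ)) : ℝ≥0∞ :=
  (∫⁻ x in Q, f x) / MeasureTheory.volume Q

/-- The uncentered Hardy–Littlewood maximal operator over axis-parallel cubes,
for `ℝ≥0∞`-valued functions. -/
def hlM {n : ℕ} (f : (Fin n → ℝ) → ℝ≥0∞) (x : Fin n → ℝ) : ℝ≥0∞ :=
  ⨆ (Q : Set (Fin n → ℝ)) (_ : IsCube Q) (_ : x ∈ Q), cubeAvg f Q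

/-- The Hardy–Littlewood maximal operator applied to a real-valued function:
`Mf(x) = sup_{Q ∋ x} (1/|Q|) ∫_Q |f|`. -/
def hlMR {n : ℕ} (f : (Fin n → ℝ) → ℝ) : (Fin n → ℝ) → ℝ≥0∞ :=
  hlM (fun y => ENNReal.ofReal |f y|)

/-- A weight: a locally integrable, a.e. positive function. -/
def IsWeight {n : ℕ} (w : (Fin n → ℝ) → ℝ) : Prop :=
  MeasureTheory.LocallyIntegrable w MeasureTheory.volume ∧
    ∀ᵐ x ∂(MeasureTheory.volume : MeasureTheory.Measure (Fin n → ℝ)), 0 < w x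

/-- `w(E) = ∫_E w dx`. -/
def wMeas {n : ℕ} (w : (Fin n → ℝ) → ℝ) (E : Set (Fin n → ℝ)) : ℝ≥0∞ :=
  ∫⁻ x in E, ENNReal.ofReal (w x)

/-- The `A₁` constant `[w]_{A₁} = ess sup_x M w(x) / w(x)`. -/
def a1Const {n : ℕ} (w : (Fin n → ℝ) → ℝ) : ℝ≥0∞ :=
  essSup (fun x => hlM (fun y => ENNReal.ofReal (w y)) x / ENNReal.ofReal (w x))
    MeasureTheory.volume

/-- The Fujii–Wilson `A_∞` constant `[w]_{A_∞} = sup_Q (1/∫_Q w) ∫_Q M(w·1_Q)`. -/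
def aInfConst {n : ℕ} (w : (Fin n → ℝ) → ℝ) : ℝ≥0∞ :=
  ⨆ (Q : Set (Fin n → ℝ)) (_ : IsCube Q),
    (∫⁻ x in Q, hlM (Q.indicator fun y => ENNReal.ofReal (w y)) x) / wMeas w Q

/-- The `A_p` constant, `1 < p < ∞`:
`[w]_{A_p} = sup_Q ⟨w⟩_Q (⟨w^{-1/(p-1)}⟩_Q)^{p-1}`. -/
def apConst {n : ℕ} (p : ℝ) (w : (Fin n → ℝ) → ℝ) : ℝ≥0∞ :=
  ⨆ (Q : Set (Fin n → ℝ)) (_ : IsCube Q),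
    cubeAvg (fun y => ENNReal.ofReal (w y)) Q *
      (cubeAvg (fun y => ENNReal.ofReal (w y) ^ (-(1 / (p - 1)))) Q) ^ (p - 1)

/-- The weak norm `‖g‖_{L^{1,∞}(σ)} = sup_{t>0} t · σ({x : g(x) > t})`
for an `ℝ≥0∞`-valued function `g` and a weight `σ`. -/
def wkNorm {n : ℕ} (g : (Fin n → ℝ) → ℝ≥0∞) (σ : (Fin n → ℝ) → ℝ) : ℝ≥0∞ :=
  ⨆ (t : ℝ≥0) (_ : 0 < t), (t : ℝ≥0∞) * wMeas σ {x | (t : ℝ≥0∞) < g x}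

/-- `‖f‖_{L¹(σ)} = ∫ |f| σ dx`. -/
def l1Norm {n : ℕ} (f : (Fin n → ℝ) → ℝ) (σ : (Fin n → ℝ) → ℝ) : ℝ≥0∞ :=
  ∫⁻ x, ENNReal.ofReal |f x| * ENNReal.ofReal (σ x)

/-- `‖g‖_{L^p(σ)} = (∫ g^p σ dx)^{1/p}` for an `ℝ≥0∞`-valued `g`. -/
def lpNormE {n : ℕ} (p : ℝ) (g : (Fin n → ℝ) → ℝ≥0∞) (σ : (Fin n → ℝ) → ℝ) : ℝ≥0∞ :=
  (∫⁻ x, g x ^ p * ENNReal.ofReal (σ x)) ^ (1 / p)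

/-- A bounded, compactly supported measurable function. -/
def BddCompSupp {n : ℕ} (f : (Fin n → ℝ) → ℝ) : Prop :=
  Measurable f ∧ (∃ C : ℝ, ∀ x, |f x| ≤ C) ∧ HasCompactSupport f

end


/-- A nested sequence of countable measurable partitions of `α`; `cell m y` is the piece of the
`m`-th partition containing `y`. -/
structure NestedCells (α : Type*) [MeasurableSpace α] where
  cell : ℕ → α → Set α
  mem_self : ∀ m y, y ∈ cell m y
  eq_of_mem : ∀ m y z, z ∈ cell m y → cell m z = cell m y
  succ_subset : ∀ m y, cell (m + 1) y ⊆ cell m y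
  countable_range : ∀ m, (Set.range (cell m)).Countable
  measurableSet_cell : ∀ m y, MeasurableSet (cell m y)

namespace NestedCells

variable {α : Type*} [MeasurableSpace α] (c : NestedCells α)

lemma cell_subset {m k : ℕ} (h : m ≤ k) (y : α) : c.cell k y ⊆ c.cell m y := by
  induction k, h using Nat.le_induction with
  | base => exact subset_rfl
  | succ k _ ih => exact (c.succ_subset k y).trans ih

/-- A measure comparison on suitable cells inside `S` passes to `S`. -/
lemma measure_le_of_cells (μ ν : Measure α) (C : ℝ≥0∞) (S : Set α)
    (hS : ∀ y ∈ S, ∃ m, c.cell m y ⊆ S ∧ μ (c.cell m y) ≤ C * ν (c.cell m y)) :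
    μ S ≤ C * ν S := by
  classical
  let N : α → ℕ := fun y => if h : y ∈ S then Nat.find (hS y h) else 0
  have hN : ∀ y ∈ S, c.cell (N y) y ⊆ S ∧ μ (c.cell (N y) y) ≤ C * ν (c.cell (N y) y) := by
    intro y h
    simp only [N, h, dif_pos]
    exact Nat.find_spec (hS y h)
  have hmin : ∀ y ∈ S, ∀ m, c.cell m y ⊆ S → μ (c.cell m y) ≤ C * ν (c.cell m y) → N y ≤ m := by
    intro y h m h1 h2
    simp only [N, h, dif_pos]
    exact Nat.find_min' (hS y h) ⟨h1, h2⟩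
  let T : Set (Set α) := (fun y => c.cell (N y) y) '' S
  have hTc : T.Countable := by
    refine (Set.countable_iUnion c.countable_range).mono ?_
    rintro _ ⟨y, -, rfl⟩
    exact Set.mem_iUnion.2 ⟨N y, y, rfl⟩
  have hTU : ⋃₀ T = S := by
    apply Set.Subset.antisymm
    · rintro z ⟨_, ⟨y, hy, rfl⟩, hz⟩
      exact (hN y hy).1 hz
    · intro y hy
      exact ⟨_, ⟨y, hy, rfl⟩, c.mem_self _ _⟩
  have key : ∀ y ∈ S, ∀ z ∈ S, ∀ x, x ∈ c.cell (N y) y → x ∈ c.cell (N z) z → N z ≤ N y →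
      c.cell (N y) y = c.cell (N z) z := by
    intro y hy z hz x hxy hxz hle
    have h1 := c.eq_of_mem _ _ _ hxy
    have h2 := c.eq_of_mem _ _ _ hxz
    have hyz : c.cell (N z) y = c.cell (N z) z := by
      rw [← h2]
      have : y ∈ c.cell (N y) x := h1 ▸ c.mem_self _ y
      exact c.eq_of_mem _ _ _ (c.cell_subset hle x this)
    have := hmin y hy (N z) (hyz ▸ (hN z hz).1) (hyz ▸ (hN z hz).2)
    rw [le_antisymm this hle, hyz]
  have hdisj : T.Pairwise Disjoint := by
    rintro _ ⟨y, hy, rfl⟩ _ ⟨z, hz, rfl⟩ hne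
    rw [Set.disjoint_left]
    intro x hxy hxz
    rcases le_total (N z) (N y) with h | h
    · exact hne (key y hy z hz x hxy hxz h)
    · exact hne (key z hz y hy x hxz hxy h).symm
  have hTm : ∀ t ∈ T, MeasurableSet t := by
    rintro _ ⟨y, -, rfl⟩
    exact c.measurableSet_cell _ _
  rw [← hTU, measure_sUnion hTc hdisj hTm, measure_sUnion hTc hdisj hTm, ← ENNReal.tsum_mul_left]
  refine ENNReal.tsum_le_tsum ?_
  rintro ⟨_, y, hy, rfl⟩
  exact (hN y hy).2

/-- The points of `cell 0 q` where the maximal function along the cells exceeds `l`. -/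
def maximalLevelSet (μ ν : Measure α) (q : α) (l : ℝ≥0∞) : Set α :=
  {y | y ∈ c.cell 0 q ∧ ∃ m, l * μ (c.cell m y) < ν (c.cell m y)}

lemma measurableSet_maximalLevelSet (μ ν : Measure α) (q : α) (l : ℝ≥0∞) :
    MeasurableSet (c.maximalLevelSet μ ν q l) := by
  have : c.maximalLevelSet μ ν q l =
      c.cell 0 q ∩ ⋃ m, ⋃₀ {P ∈ Set.range (c.cell m) | l * μ P < ν P} := by
    ext y
    simp only [maximalLevelSet, Set.mem_ofPred_eq, Set.mem_inter_iff, Set.mem_iUnion,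
      Set.mem_sUnion, Set.mem_range]
    refine and_congr_right fun _ => exists_congr fun m => ⟨fun h => ⟨_, ⟨⟨y, rfl⟩, h⟩,
      c.mem_self _ _⟩, ?_⟩
    rintro ⟨_, ⟨⟨z, rfl⟩, h⟩, hy⟩
    rwa [c.eq_of_mem _ _ _ hy]
  rw [this]
  refine (c.measurableSet_cell _ _).inter (MeasurableSet.iUnion fun m => ?_)
  refine MeasurableSet.sUnion ((c.countable_range m).mono fun P hP => hP.1) ?_
  rintro _ ⟨⟨z, rfl⟩, -⟩
  exact c.measurableSet_cell _ _

lemma maximalLevelSet_anti (μ ν : Measure α) (q : α) {l l' : ℝ≥0∞} (h : l ≤ l') :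
    c.maximalLevelSet μ ν q l' ⊆ c.maximalLevelSet μ ν q l := by
  rintro y ⟨hy, m, hm⟩
  exact ⟨hy, m, lt_of_le_of_lt (by gcongr) hm⟩

lemma measure_maximalLevelSet_le (μ ν : Measure α) (q : α) {D K l : ℝ≥0∞}
    (hD1 : 1 ≤ D) (hD : D ≠ ∞)
    (hdouble : ∀ m y, μ (c.cell m y) ≤ D * μ (c.cell (m + 1) y))
    (hpos : ∀ m y, μ (c.cell m y) ≠ 0) (hfin : ∀ m y, μ (c.cell m y) ≠ ∞)
    (hA : ∀ m y S, S ⊆ c.cell m y → MeasurableSet S →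
      ν (c.cell m y) * μ S ≤ K * ν S * μ (c.cell m y))
    (hl0 : l ≠ 0) (hl : l ≠ ∞) (hq : ν (c.cell 0 q) ≤ l * μ (c.cell 0 q)) :
    ν (c.maximalLevelSet μ ν q l) ≤
      2 * K * ν (c.maximalLevelSet μ ν q l \ c.maximalLevelSet μ ν q (2 * D * l)) := by
  classical
  set W := c.maximalLevelSet μ ν q l with hW
  set W' := c.maximalLevelSet μ ν q (2 * D * l) with hW'
  have hW'm : MeasurableSet W' := c.measurableSet_maximalLevelSet _ _ _ _
  have hle : l ≤ 2 * D * l := by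
    calc l = 1 * 1 * l := by simp
      _ ≤ 2 * D * l := by gcongr; exact one_le_two
  have main := c.measure_le_of_cells ν (ν.restrict W'ᶜ) (2 * K) W ?_
  · rwa [Measure.restrict_apply' hW'm.compl, ← Set.sdiff_eq] at main
  rintro y ⟨hyq, hex⟩
  refine ⟨Nat.find hex, ?_⟩
  have hspec := Nat.find_spec hex
  have hmin : ∀ k, k < Nat.find hex → ν (c.cell k y) ≤ l * μ (c.cell k y) :=
    fun k hk => not_lt.1 (Nat.find_min hex hk)
  set m := Nat.find hex
  have hPq : c.cell m y ⊆ c.cell 0 q := by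
    rw [← c.eq_of_mem _ _ _ hyq]
    exact c.cell_subset (Nat.zero_le m) y
  have hPW : c.cell m y ⊆ W := fun z hz => ⟨hPq hz, m, by rwa [c.eq_of_mem _ _ _ hz]⟩
  refine ⟨hPW, ?_⟩
  have hm : m ≠ 0 := by
    intro h0
    rw [h0, c.eq_of_mem _ _ _ hyq] at hspec
    exact absurd hq (not_le.2 hspec)
  obtain ⟨k, hk⟩ := Nat.exists_eq_succ_of_ne_zero hm
  have hup : ν (c.cell m y) ≤ l * D * μ (c.cell m y) := by
    calc ν (c.cell m y) ≤ ν (c.cell k y) := measure_mono (c.cell_subset (by omega) y)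
      _ ≤ l * μ (c.cell k y) := hmin k (by omega)
      _ ≤ l * (D * μ (c.cell (k + 1) y)) := by gcongr; exact hdouble k y
      _ = l * D * μ (c.cell m y) := by rw [hk, mul_assoc]
  have hsmall : (2 * D * l) * μ (c.cell m y ∩ W') ≤ ν (c.cell m y ∩ W') := by
    have := c.measure_le_of_cells ((2 * D * l) • μ) ν 1 (c.cell m y ∩ W') ?_
    · simpa using this
    rintro z ⟨hzP, hzq, k', hk'⟩
    have hmk : m ≤ k' := by
      by_contra hlt
      have hzy : c.cell k' z = c.cell k' y :=
        c.eq_of_mem _ _ _ (c.cell_subset (not_le.1 hlt).le y hzP)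
      rw [hzy] at hk'
      have h1 := hmin k' (not_le.1 hlt)
      exact absurd (h1.trans (by gcongr : l * μ (c.cell k' y) ≤ 2 * D * l * μ (c.cell k' y)))
        (not_le.2 hk')
    refine ⟨k', ?_, by simpa using hk'.le⟩
    intro x hx
    have hxP : x ∈ c.cell m y := by
      rw [← c.eq_of_mem _ _ _ hzP]
      exact c.cell_subset hmk z hx
    exact ⟨hxP, hPq hxP, k', by rwa [c.eq_of_mem _ _ _ hx]⟩
  have hhalf : 2 * μ (c.cell m y ∩ W') ≤ μ (c.cell m y) := by
    have h1 : (l * D) * (2 * μ (c.cell m y ∩ W')) ≤ (l * D) * μ (c.cell m y) := by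
      calc (l * D) * (2 * μ (c.cell m y ∩ W')) = (2 * D * l) * μ (c.cell m y ∩ W') := by ring
        _ ≤ ν (c.cell m y ∩ W') := hsmall
        _ ≤ ν (c.cell m y) := measure_mono Set.inter_subset_left
        _ ≤ _ := hup
    have hD0 : D ≠ 0 := (zero_lt_one.trans_le hD1).ne'
    exact (ENNReal.mul_le_mul_iff_right (mul_ne_zero hl0 hD0) (ENNReal.mul_ne_top hl hD)).1 h1
  have hPm := c.measurableSet_cell m y
  have hbig : μ (c.cell m y) ≤ 2 * μ (c.cell m y \ W') := by
    have h1 := measure_inter_add_sdiff (μ := μ) (c.cell m y) hW'm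
    have h2 : μ (c.cell m y ∩ W') ≠ ∞ := measure_ne_top_of_subset Set.inter_subset_left (hfin m y)
    have h3 : μ (c.cell m y ∩ W') ≤ μ (c.cell m y \ W') := by
      rw [← ENNReal.add_le_add_iff_left h2, h1, ← two_mul]
      exact hhalf
    calc μ (c.cell m y) = _ := h1.symm
      _ ≤ μ (c.cell m y \ W') + μ (c.cell m y \ W') := by gcongr
      _ = _ := (two_mul _).symm
  rw [Measure.restrict_apply' hW'm.compl, ← Set.sdiff_eq]
  have := hA m y (c.cell m y \ W') Set.sdiff_subset (hPm.diff hW'm)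
  refine (ENNReal.mul_le_mul_iff_left (hpos m y) (hfin m y)).1 ?_
  calc ν (c.cell m y) * μ (c.cell m y) ≤ ν (c.cell m y) * (2 * μ (c.cell m y \ W')) := by gcongr
    _ = 2 * (ν (c.cell m y) * μ (c.cell m y \ W')) := by ring
    _ ≤ 2 * (K * ν (c.cell m y \ W') * μ (c.cell m y)) := by gcongr
    _ = _ := by ring

/-- Geometric decay of the mass of the level sets of the cell maximal function. -/
lemma measure_maximalLevelSet_pow_le (μ ν : Measure α) (q : α) {D K l : ℝ≥0∞}
    (hD1 : 1 ≤ D) (hD : D ≠ ∞)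
    (hdouble : ∀ m y, μ (c.cell m y) ≤ D * μ (c.cell (m + 1) y))
    (hpos : ∀ m y, μ (c.cell m y) ≠ 0) (hfin : ∀ m y, μ (c.cell m y) ≠ ∞)
    (hA : ∀ m y S, S ⊆ c.cell m y → MeasurableSet S →
      ν (c.cell m y) * μ S ≤ K * ν S * μ (c.cell m y))
    (hK : K ≠ ∞) (hK0 : K ≠ 0)
    (hl0 : l ≠ 0) (hl : l ≠ ∞) (hq : ν (c.cell 0 q) ≤ l * μ (c.cell 0 q)) (j : ℕ) :
    ν (c.maximalLevelSet μ ν q ((2 * D) ^ j * l)) ≤ (1 - (2 * K)⁻¹) ^ j * ν (c.cell 0 q) := by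
  have hqfin : ν (c.cell 0 q) ≠ ∞ := ne_top_of_le_ne_top (ENNReal.mul_ne_top hl (hfin _ _)) hq
  induction j with
  | zero =>
    simp only [pow_zero, one_mul]
    exact measure_mono fun y hy => hy.1
  | succ j ih =>
    have hD2 : 1 ≤ 2 * D := hD1.trans (by rw [two_mul]; exact le_self_add)
    set l' := (2 * D) ^ j * l with hl'
    have hll' : l ≤ l' := by
      calc l = 1 * l := (one_mul _).symm
        _ ≤ l' := by rw [hl']; gcongr; exact one_le_pow_of_one_le' hD2 j
    have h1 := c.measure_maximalLevelSet_le μ ν q (l := l') hD1 hD hdouble hpos hfin hA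
      (ne_bot_of_le_ne_bot hl0 hll')
      (ENNReal.mul_ne_top (ENNReal.pow_ne_top (ENNReal.mul_ne_top (by simp) hD)) hl)
      (hq.trans (by gcongr))
    rw [pow_succ', mul_assoc (2 * D), ← hl']
    set W := c.maximalLevelSet μ ν q l'
    set W' := c.maximalLevelSet μ ν q (2 * D * l')
    have hWfin : ν W ≠ ∞ := measure_ne_top_of_subset (fun y hy => hy.1) hqfin
    have hsub : W' ⊆ W := c.maximalLevelSet_anti μ ν q (by
      calc l' = 1 * l' := (one_mul _).symm
        _ ≤ _ := by gcongr)
    have h2K0 : 2 * K ≠ 0 := mul_ne_zero (by simp) hK0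
    have h2K : 2 * K ≠ ∞ := ENNReal.mul_ne_top (by simp) hK
    have h2 : (2 * K)⁻¹ * ν W ≤ ν (W \ W') := by
      rw [mul_comm, ← div_eq_mul_inv]
      exact ENNReal.div_le_of_le_mul' h1
    have hW'm : MeasurableSet W' := c.measurableSet_maximalLevelSet _ _ _ _
    have h3 : ν W' + ν (W \ W') = ν W := by
      rw [← measure_inter_add_sdiff W hW'm, Set.inter_eq_self_of_subset_right hsub]
    calc ν W' ≤ ν W - (2 * K)⁻¹ * ν W := by
          refine ENNReal.le_sub_of_add_le_right
            (ENNReal.mul_ne_top (ENNReal.inv_ne_top.2 h2K0) hWfin) ?_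
          rw [← h3]; gcongr; rw [h3]; exact h2
      _ = (1 - (2 * K)⁻¹) * ν W := by
          rw [ENNReal.sub_mul (fun _ _ => hWfin), one_mul]
      _ ≤ (1 - (2 * K)⁻¹) * ((1 - (2 * K)⁻¹) ^ j * ν (c.cell 0 q)) := by gcongr
      _ = _ := by rw [pow_succ']; ring

end NestedCells

open Filter Topology

section Dyadic

variable {n : ℕ}

lemma isCube_closedBall (x : Fin n → ℝ) {r : ℝ} (hr : 0 < r) : IsCube (Metric.closedBall x r) := by
  refine ⟨fun i => x i - r, 2 * r, by positivity, ?_⟩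
  ext y
  rw [closedBall_pi x hr.le]
  simp only [Set.mem_univ_pi, Real.closedBall_eq_Icc, Set.mem_Icc, Set.mem_ofPred_eq]
  refine forall_congr' fun i => and_congr_right fun _ => ?_
  rw [show x i - r + 2 * r = x i + r by ring]

lemma IsCube.exists_closedBall {Q : Set (Fin n → ℝ)} (hQ : IsCube Q) :
    ∃ (x : Fin n → ℝ) (r : ℝ), 0 < r ∧ Q = Metric.closedBall x r := by
  obtain ⟨a, h, hh, rfl⟩ := hQ
  refine ⟨fun i => a i + h / 2, h / 2, by positivity, ?_⟩
  ext y
  rw [closedBall_pi _ (by positivity)]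
  simp only [Set.mem_univ_pi, Real.closedBall_eq_Icc, Set.mem_Icc, Set.mem_ofPred_eq]
  refine forall_congr' fun i => ?_
  rw [show a i + h / 2 - h / 2 = a i by ring, show a i + h / 2 + h / 2 = a i + h by ring]

/-- The index of the dyadic cell of generation `m` containing `y`, for the grid with origin `a`
and initial side length `h`. -/
noncomputable def dyadicIndex (a : Fin n → ℝ) (h : ℝ) (m : ℕ) (y : Fin n → ℝ) : Fin n → ℤ :=
  fun i => ⌊(y i - a i) / h * 2 ^ m⌋

lemma dyadicIndex_succ (a : Fin n → ℝ) (h : ℝ) (m : ℕ) (y : Fin n → ℝ) :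
    dyadicIndex a h m y = fun i => dyadicIndex a h (m + 1) y i / 2 := by
  funext i
  have := Int.floor_div_natCast ((y i - a i) / h * 2 ^ (m + 1)) 2
  simp only [dyadicIndex]
  rw [show (((2 : ℕ) : ℤ)) = 2 from rfl] at this
  rw [← this]
  congr 1
  push_cast
  ring

lemma measurable_dyadicIndex (a : Fin n → ℝ) (h : ℝ) (m : ℕ) :
    Measurable (dyadicIndex a h m) := by
  refine measurable_pi_lambda _ fun i => ?_
  exact Int.measurable_floor.comp (by fun_prop)

/-- The dyadic grid with origin `a` and initial side length `h`. -/
noncomputable def dyadicCells (a : Fin n → ℝ) (h : ℝ) : NestedCells (Fin n → ℝ) where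
  cell m y := dyadicIndex a h m ⁻¹' {dyadicIndex a h m y}
  mem_self m y := rfl
  eq_of_mem m y z hz := by rw [show dyadicIndex a h m z = dyadicIndex a h m y from hz]
  succ_subset m y z hz := by
    have hz' : dyadicIndex a h (m + 1) z = dyadicIndex a h (m + 1) y := hz
    change dyadicIndex a h m z = dyadicIndex a h m y
    rw [dyadicIndex_succ a h m z, dyadicIndex_succ a h m y, hz']
  countable_range m := by
    refine (Set.countable_range
      (fun v : Fin n → ℤ => dyadicIndex a h m ⁻¹' {v})).mono ?_
    rintro _ ⟨y, rfl⟩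
    exact ⟨_, rfl⟩
  measurableSet_cell m y := measurable_dyadicIndex a h m (measurableSet_singleton _)

lemma dyadicCells_cell_eq (a : Fin n → ℝ) {h : ℝ} (hh : 0 < h) (m : ℕ) (y : Fin n → ℝ) :
    (dyadicCells a h).cell m y = Set.univ.pi fun i =>
      Set.Ico (a i + dyadicIndex a h m y i * (h / 2 ^ m))
        (a i + dyadicIndex a h m y i * (h / 2 ^ m) + h / 2 ^ m) := by
  ext z
  change dyadicIndex a h m z = dyadicIndex a h m y ↔ _
  rw [funext_iff, Set.mem_univ_pi]
  refine forall_congr' fun i => ?_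
  generalize dyadicIndex a h m y i = k
  have hp : (0 : ℝ) < h / 2 ^ m := by positivity
  have he : (z i - a i) / h * 2 ^ m = (z i - a i) / (h / 2 ^ m) := by field_simp
  simp only [dyadicIndex, Int.floor_eq_iff, Set.mem_Ico, he]
  rw [le_div_iff₀ hp, div_lt_iff₀ hp]
  constructor <;> rintro ⟨h1, h2⟩ <;> constructor <;> linarith

/-- The center of the dyadic cell of generation `m` containing `y`. -/
noncomputable def dyadicCenter (a : Fin n → ℝ) (h : ℝ) (m : ℕ) (y : Fin n → ℝ) : Fin n → ℝ :=
  fun i => a i + dyadicIndex a h m y i * (h / 2 ^ m) + h / 2 ^ m / 2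

lemma closedBall_dyadicCenter (a : Fin n → ℝ) {h : ℝ} (hh : 0 < h) (m : ℕ) (y : Fin n → ℝ) :
    Metric.closedBall (dyadicCenter a h m y) (h / 2 ^ m / 2) =
      Set.Icc (fun i => a i + dyadicIndex a h m y i * (h / 2 ^ m))
        (fun i => a i + dyadicIndex a h m y i * (h / 2 ^ m) + h / 2 ^ m) := by
  rw [closedBall_pi _ (by positivity), ← Set.pi_univ_Icc]
  congr 1
  funext i
  rw [Real.closedBall_eq_Icc, dyadicCenter]
  congr 1 <;> ring

lemma dyadicCells_cell_subset (a : Fin n → ℝ) {h : ℝ} (hh : 0 < h) (m : ℕ) (y : Fin n → ℝ) :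
    (dyadicCells a h).cell m y ⊆ Metric.closedBall (dyadicCenter a h m y) (h / 2 ^ m / 2) := by
  rw [closedBall_dyadicCenter a hh, dyadicCells_cell_eq a hh, ← Set.pi_univ_Icc]
  exact Set.pi_mono fun i _ => Set.Ico_subset_Icc_self

lemma dyadicCells_cell_ae_eq (a : Fin n → ℝ) {h : ℝ} (hh : 0 < h) (m : ℕ) (y : Fin n → ℝ) :
    (dyadicCells a h).cell m y =ᵐ[volume]
      Metric.closedBall (dyadicCenter a h m y) (h / 2 ^ m / 2) := by
  rw [closedBall_dyadicCenter a hh, dyadicCells_cell_eq a hh]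
  exact Measure.univ_pi_Ico_ae_eq_Icc

lemma volume_dyadicCells_cell (a : Fin n → ℝ) {h : ℝ} (hh : 0 < h) (m : ℕ) (y : Fin n → ℝ) :
    volume ((dyadicCells a h).cell m y) = ENNReal.ofReal ((h / 2 ^ m) ^ n) := by
  rw [measure_congr (dyadicCells_cell_ae_eq a hh m y),
    Real.volume_pi_closedBall _ (by positivity), Fintype.card_fin]
  congr 2
  ring

lemma volume_dyadicCells_cell_succ (a : Fin n → ℝ) {h : ℝ} (hh : 0 < h) (m : ℕ) (y : Fin n → ℝ) :
    volume ((dyadicCells a h).cell m y) = 2 ^ n * volume ((dyadicCells a h).cell (m + 1) y) := by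
  rw [volume_dyadicCells_cell a hh, volume_dyadicCells_cell a hh,
    show (2 : ℝ≥0∞) ^ n = ENNReal.ofReal (2 ^ n) by
      rw [ENNReal.ofReal_pow (by norm_num)]; simp,
    ← ENNReal.ofReal_mul (by positivity), ← mul_pow]
  congr 2
  rw [pow_succ]
  field_simp

/-- Almost every point where `w` exceeds `l` lies in a dyadic cell on which the average of `w`
exceeds `l`. -/
lemma ae_exists_lt_dyadicCells (a : Fin n → ℝ) {h : ℝ} (hh : 0 < h) {w : (Fin n → ℝ) → ℝ≥0∞}
    (hw : Measurable w) (q : Fin n → ℝ)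
    (hfin : volume.withDensity w ((dyadicCells a h).cell 0 q) ≠ ∞) (l : ℝ≥0∞) :
    ∀ᵐ z, z ∈ (dyadicCells a h).cell 0 q → l < w z →
      ∃ m, l * volume ((dyadicCells a h).cell m z) <
        volume.withDensity w ((dyadicCells a h).cell m z) := by
  set Q := (dyadicCells a h).cell 0 q with hQ
  have hQm : MeasurableSet Q := (dyadicCells a h).measurableSet_cell _ _
  have hint : ∫⁻ y, Q.indicator w y ≠ ∞ := by
    rwa [lintegral_indicator hQm, ← withDensity_apply' w]
  have hδ : Tendsto (fun m : ℕ => h / 2 ^ m / 2) atTop (𝓝[>] 0) := by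
    rw [tendsto_nhdsWithin_iff]
    refine ⟨?_, Eventually.of_forall fun m => Set.mem_Ioi.2 (by positivity)⟩
    have := (tendsto_pow_atTop_nhds_zero_of_lt_one (r := (1 / 2 : ℝ)) (by norm_num)
      (by norm_num)).const_mul (h / 2)
    rw [mul_zero] at this
    refine this.congr fun m => ?_
    rw [div_pow, one_pow]
    ring
  filter_upwards [(IsUnifLocDoublingMeasure.vitaliFamily (volume : Measure (Fin n → ℝ)) 1
    ).ae_tendsto_lintegral_div (hw.indicator hQm).aemeasurable hint] with z hz hzQ hlt
  rw [Set.indicator_of_mem hzQ] at hz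
  have hball := IsUnifLocDoublingMeasure.tendsto_closedBall_filterAt
    (volume : Measure (Fin n → ℝ)) (K := 1) (x := z) (fun m => dyadicCenter a h m z)
    (fun m : ℕ => h / 2 ^ m / 2) hδ (Eventually.of_forall fun m => by
      rw [one_mul]
      exact dyadicCells_cell_subset a hh m z ((dyadicCells a h).mem_self m z))
  obtain ⟨m, hm⟩ := ((hz.comp hball).eventually_const_lt hlt).exists
  refine ⟨m, ?_⟩
  simp only [Function.comp_apply] at hm
  rw [← setLIntegral_congr (dyadicCells_cell_ae_eq a hh m z),
    ← measure_congr (dyadicCells_cell_ae_eq a hh m z)] at hm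
  have hm' := ENNReal.mul_lt_of_lt_div hm
  refine hm'.trans_le ?_
  rw [withDensity_apply']
  exact lintegral_mono fun y => Set.indicator_le_self _ _ y

end Dyadic

section Weight

variable {n : ℕ} {w : (Fin n → ℝ) → ℝ≥0∞} {K : ℝ≥0∞}

lemma setLIntegral_closedBall_le_hlM_mul (g : (Fin n → ℝ) → ℝ≥0∞) {x c : Fin n → ℝ} {r : ℝ}
    (hr : 0 < r) (hx : x ∈ Metric.closedBall c r) :
    ∫⁻ y in Metric.closedBall c r, g y ≤ hlM g x * volume (Metric.closedBall c r) := by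
  have h1 : cubeAvg g (Metric.closedBall c r) ≤ hlM g x :=
    le_iSup_of_le _ (le_iSup_of_le (isCube_closedBall c hr) (le_iSup_of_le hx le_rfl))
  refine (ENNReal.div_le_iff ?_ ?_).1 h1
  · exact (Metric.measure_closedBall_pos _ _ hr).ne'
  · exact measure_closedBall_lt_top.ne

/-- The `A₁` condition compares masses of a ball and of its measurable subsets. -/
lemma withDensity_closedBall_mul_le (hw : Measurable w) (hA : ∀ᵐ x, hlM w x ≤ K * w x)
    (c : Fin n → ℝ) {r : ℝ} (hr : 0 < r) {S : Set (Fin n → ℝ)}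
    (hS : S ⊆ Metric.closedBall c r) (hSm : MeasurableSet S) :
    volume.withDensity w (Metric.closedBall c r) * volume S ≤
      K * volume.withDensity w S * volume (Metric.closedBall c r) := by
  rw [withDensity_apply', withDensity_apply', ← setLIntegral_const]
  calc ∫⁻ _ in S, ∫⁻ y in Metric.closedBall c r, w y
      ≤ ∫⁻ x in S, K * w x * volume (Metric.closedBall c r) := by
        refine setLIntegral_mono_ae' hSm ?_
        filter_upwards [hA] with x hx hxS
        exact (setLIntegral_closedBall_le_hlM_mul w hr (hS hxS)).trans (by gcongr)
    _ = _ := by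
        rw [lintegral_mul_const _ (hw.const_mul K), lintegral_const_mul _ hw]

/-- Exponential decay of the mass of the level sets of an `A₁` weight in a cube. -/
lemma withDensity_levelSet_le (hw : Measurable w) (hA : ∀ᵐ x, hlM w x ≤ K * w x)
    (hK : K ≠ ∞) (hK0 : K ≠ 0) (x₀ : Fin n → ℝ) {r : ℝ} (hr : 0 < r) {l : ℝ≥0∞}
    (hl0 : l ≠ 0) (hl : l ≠ ∞)
    (hB : volume.withDensity w (Metric.closedBall x₀ r) ≤ l * volume (Metric.closedBall x₀ r))
    (j : ℕ) :
    volume.withDensity w (Metric.closedBall x₀ r ∩ {x | (2 * 2 ^ n) ^ j * l < w x}) ≤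
      (1 - (2 * K)⁻¹) ^ j * volume.withDensity w (Metric.closedBall x₀ r) := by
  set a : Fin n → ℝ := fun i => x₀ i - r with ha
  have hh : 0 < 2 * r := by positivity
  set c := dyadicCells a (2 * r) with hc
  have hcen : dyadicCenter a (2 * r) 0 a = x₀ := by
    funext i
    simp [dyadicCenter, dyadicIndex, ha]
  have hcell : c.cell 0 a =ᵐ[volume] Metric.closedBall x₀ r := by
    have := dyadicCells_cell_ae_eq a hh 0 a
    rwa [hcen, pow_zero, div_one, mul_div_cancel_left₀ _ (two_ne_zero' ℝ)] at this
  set ν := volume.withDensity w with hν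
  have hac : ν ≪ volume := withDensity_absolutelyContinuous _ _
  have hνcell : ν (c.cell 0 a) = ν (Metric.closedBall x₀ r) := measure_congr (hac.ae_eq hcell)
  have hq : ν (c.cell 0 a) ≤ l * volume (c.cell 0 a) := by
    rwa [hνcell, measure_congr hcell]
  have hνfin : ν (c.cell 0 a) ≠ ∞ := by
    refine ne_top_of_le_ne_top (ENNReal.mul_ne_top hl ?_) hq
    rw [measure_congr hcell]
    exact measure_closedBall_lt_top.ne
  have hdecay := c.measure_maximalLevelSet_pow_le volume ν a (D := 2 ^ n) (K := K) (l := l)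
    (one_le_pow_of_one_le' one_le_two n) (by simp)
    (fun m y => (volume_dyadicCells_cell_succ a hh m y).le)
    (fun m y => by
      rw [hc, volume_dyadicCells_cell a hh, Ne, ENNReal.ofReal_eq_zero, not_le]; positivity)
    (fun m y => by rw [hc, volume_dyadicCells_cell a hh]; exact ENNReal.ofReal_ne_top)
    (fun m y S hS hSm => by
      have hae := dyadicCells_cell_ae_eq a hh m y
      rw [measure_congr hae, measure_congr (hac.ae_eq hae)]
      exact withDensity_closedBall_mul_le hw hA _ (by positivity)
        (hS.trans (dyadicCells_cell_subset a hh m y)) hSm)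
    hK hK0 hl0 hl hq j
  rw [hνcell] at hdecay
  refine le_trans (measure_mono_ae ?_) hdecay
  have h1 := ae_exists_lt_dyadicCells a hh hw a hνfin ((2 * 2 ^ n) ^ j * l)
  refine hac.ae_le ?_
  filter_upwards [h1, hcell.mem_iff] with z hz hmem
  rintro ⟨hzB, hzw⟩
  exact ⟨hmem.2 hzB, hz (hmem.2 hzB) hzw⟩

end Weight

section WeakType

variable {n : ℕ} {w : (Fin n → ℝ) → ℝ≥0∞} {K : ℝ≥0∞}

lemma exists_closedBall_of_lt_hlM {g : (Fin n → ℝ) → ℝ≥0∞} {x : Fin n → ℝ} {T : ℝ≥0∞}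
    (h : T < hlM g x) : ∃ (c : Fin n → ℝ) (r : ℝ), 0 < r ∧ x ∈ Metric.closedBall c r ∧
      T * volume (Metric.closedBall c r) < ∫⁻ y in Metric.closedBall c r, g y := by
  simp only [hlM, lt_iSup_iff] at h
  obtain ⟨Q, hQ, hx, hlt⟩ := h
  obtain ⟨c, r, hr, rfl⟩ := hQ.exists_closedBall
  exact ⟨c, r, hr, hx, ENNReal.mul_lt_of_lt_div hlt⟩

lemma hlM_le_of_forall_closedBall {g : (Fin n → ℝ) → ℝ≥0∞} {x : Fin n → ℝ} {T : ℝ≥0∞}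
    (h : ∀ (c : Fin n → ℝ) (r : ℝ), 0 < r → x ∈ Metric.closedBall c r →
      ∫⁻ y in Metric.closedBall c r, g y ≤ T * volume (Metric.closedBall c r)) :
    hlM g x ≤ T := by
  by_contra hlt
  obtain ⟨c, r, hr, hx, hc⟩ := exists_closedBall_of_lt_hlM (not_le.1 hlt)
  exact absurd (h c r hr hx) (not_le.2 hc)

lemma hlM_congr_ae {f g : (Fin n → ℝ) → ℝ≥0∞} (h : f =ᵐ[volume] g) : hlM f = hlM g := by
  funext x
  simp only [hlM, cubeAvg]
  refine iSup_congr fun Q => iSup_congr fun _ => iSup_congr fun _ => ?_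
  rw [lintegral_congr_ae (ae_restrict_of_ae h)]

/-- A dual form of the weak type inequality for the maximal function with bounded radii. -/
lemma mul_volume_le_lintegral_mul_hlM {g : (Fin n → ℝ) → ℝ≥0∞} (hg : Measurable g)
    {E : Set (Fin n → ℝ)} (hE : MeasurableSet E) (R : ℝ) (T : ℝ≥0∞) :
    T * volume {x | x ∈ E ∧ ∃ (c : Fin n → ℝ) (r : ℝ), 0 < r ∧ r ≤ R ∧
        x ∈ Metric.closedBall c r ∧
        T * volume (Metric.closedBall c r) < ∫⁻ y in Metric.closedBall c r, g y} ≤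
      5 ^ n * ∫⁻ x, g x * hlM (E.indicator 1) x := by
  set S := {x | x ∈ E ∧ ∃ (c : Fin n → ℝ) (r : ℝ), 0 < r ∧ r ≤ R ∧
        x ∈ Metric.closedBall c r ∧
        T * volume (Metric.closedBall c r) < ∫⁻ y in Metric.closedBall c r, g y} with hS
  let B : (Fin n → ℝ) × ℝ → Set (Fin n → ℝ) := fun p => Metric.closedBall p.1 p.2
  obtain ⟨v, hvt, hvd, hvc⟩ := Vitali.exists_disjoint_subfamily_covering_enlargement_closedBall
    {p : (Fin n → ℝ) × ℝ | 0 < p.2 ∧ p.2 ≤ R ∧ T * volume (B p) < ∫⁻ y in B p, g y}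
    Prod.fst Prod.snd R (fun p hp => hp.2.1) 5 (by norm_num)
  have hvcount : v.Countable := by
    refine hvd.countable_of_nonempty_interior fun p hp => ?_
    exact ⟨p.1, Metric.ball_subset_interior_closedBall (Metric.mem_ball_self (hvt hp).1)⟩
  have hcover : S ⊆ ⋃ p ∈ v, E ∩ Metric.closedBall p.1 (5 * p.2) := by
    rintro x ⟨hxE, c, r, hr, hrR, hx, hlt⟩
    obtain ⟨p, hp, hsub⟩ := hvc (c, r) ⟨hr, hrR, hlt⟩
    exact Set.mem_biUnion hp ⟨hxE, hsub hx⟩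
  have hball : ∀ p ∈ v, T * volume (E ∩ Metric.closedBall p.1 (5 * p.2)) ≤
      5 ^ n * ∫⁻ x in B p, g x * hlM (E.indicator 1) x := by
    intro p hp
    obtain ⟨hp0, -, hlt⟩ := hvt hp
    have hpos : volume (B p) ≠ 0 := (Metric.measure_closedBall_pos _ _ hp0).ne'
    have hfin : volume (B p) ≠ ∞ := measure_closedBall_lt_top.ne
    have hvol : volume (Metric.closedBall p.1 (5 * p.2)) = 5 ^ n * volume (B p) := by
      simp only [B]
      rw [Real.volume_pi_closedBall _ (by positivity), Real.volume_pi_closedBall _ hp0.le,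
        show (5 : ℝ≥0∞) ^ n = ENNReal.ofReal (5 ^ n) by
          rw [ENNReal.ofReal_pow (by norm_num)]; simp,
        ← ENNReal.ofReal_mul (by positivity), Fintype.card_fin, ← mul_pow]
      congr 2
      ring
    have hEx : ∀ x ∈ B p, volume (E ∩ Metric.closedBall p.1 (5 * p.2)) ≤
        hlM (E.indicator 1) x * (5 ^ n * volume (B p)) := by
      intro x hx
      have := setLIntegral_closedBall_le_hlM_mul (E.indicator 1) (c := p.1) (r := 5 * p.2)
        (by positivity) (Metric.closedBall_subset_closedBall (by linarith) hx)
      rwa [hvol, lintegral_indicator_one hE, Measure.restrict_apply hE] at this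
    set e := volume (E ∩ Metric.closedBall p.1 (5 * p.2))
    refine (ENNReal.mul_le_mul_iff_left hpos hfin).1 ?_
    calc T * e * volume (B p) = (T * volume (B p)) * e := by ring
      _ ≤ (∫⁻ y in B p, g y) * e := by gcongr
      _ = ∫⁻ y in B p, g y * e := (lintegral_mul_const _ hg).symm
      _ ≤ ∫⁻ y in B p, (5 ^ n * volume (B p)) * (g y * hlM (E.indicator 1) y) := by
          refine setLIntegral_mono' measurableSet_closedBall fun y hy => ?_
          calc g y * e ≤ g y * (hlM (E.indicator 1) y * (5 ^ n * volume (B p))) := by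
                gcongr; exact hEx y hy
            _ = _ := by ring
      _ = (5 ^ n * volume (B p)) * ∫⁻ y in B p, g y * hlM (E.indicator 1) y :=
          lintegral_const_mul' _ _ (ENNReal.mul_ne_top (by simp) hfin)
      _ = _ := by ring
  calc T * volume S ≤ T * ∑' p : v, volume (E ∩ Metric.closedBall p.1.1 (5 * p.1.2)) := by
        gcongr
        exact (measure_mono hcover).trans (measure_biUnion_le _ hvcount _)
    _ = ∑' p : v, T * volume (E ∩ Metric.closedBall p.1.1 (5 * p.1.2)) :=
        ENNReal.tsum_mul_left.symm
    _ ≤ ∑' p : v, 5 ^ n * ∫⁻ x in B p.1, g x * hlM (E.indicator 1) x :=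
        ENNReal.tsum_le_tsum fun p => hball p.1 p.2
    _ = 5 ^ n * ∫⁻ x in ⋃ p ∈ v, B p, g x * hlM (E.indicator 1) x := by
        rw [ENNReal.tsum_mul_left, lintegral_biUnion hvcount
          (fun p _ => measurableSet_closedBall) hvd]
    _ ≤ _ := by gcongr; exact Measure.restrict_le_self

/-- The set where `w` lies between two consecutive powers of `b`. -/
def levelLayer (w : (Fin n → ℝ) → ℝ≥0∞) (b : ℝ≥0∞) (k : ℤ) : Set (Fin n → ℝ) :=
  w ⁻¹' Set.Ioc (b ^ k) (b ^ (k + 1))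

lemma hlM_indicator_one_le_one (E : Set (Fin n → ℝ)) (x : Fin n → ℝ) :
    hlM (E.indicator 1) x ≤ 1 := by
  refine hlM_le_of_forall_closedBall fun c r _ _ => ?_
  rw [one_mul]
  calc ∫⁻ y in Metric.closedBall c r, E.indicator 1 y ≤ ∫⁻ _ in Metric.closedBall c r, 1 :=
        lintegral_mono fun y => Set.indicator_le_self _ _ y
    _ = _ := by simp

lemma tsum_zpow_mul_hlM_levelLayer_le (hw : Measurable w) (hA : ∀ᵐ x, hlM w x ≤ K * w x)
    (hK : K ≠ ∞) (hK1 : 1 ≤ K) {x : Fin n → ℝ} (hx : hlM w x ≤ K * w x)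
    (hx0 : w x ≠ 0) (hx1 : w x ≠ ∞) :
    ∑' k : ℤ, (2 * 2 ^ n : ℝ≥0∞) ^ k * hlM ((levelLayer w (2 * 2 ^ n) k).indicator 1) x ≤
      4 * K ^ 2 * w x := by
  set b : ℝ≥0∞ := 2 * 2 ^ n with hb
  have hb2 : 2 ≤ b := by
    calc (2 : ℝ≥0∞) = 2 * 1 := (mul_one _).symm
      _ ≤ b := by rw [hb]; gcongr; exact one_le_pow_of_one_le' one_le_two n
  have hbfin : b ≠ ∞ := ENNReal.mul_ne_top (by simp) (by simp)
  have hb0 : b ≠ 0 := (two_pos.trans_le hb2).ne'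
  have hK0 : K ≠ 0 := (one_pos.trans_le hK1).ne'
  have hA0 : K * w x ≠ 0 := mul_ne_zero hK0 hx0
  have hA1 : K * w x ≠ ∞ := ENNReal.mul_ne_top hK hx1
  obtain ⟨k₀, hk₀, hk₁⟩ := ENNReal.exists_mem_Ioc_zpow hA0 hA1 (ENNReal.one_lt_two.trans_le hb2) hbfin
  set F : ℤ → ℝ≥0∞ := fun k => b ^ k * hlM ((levelLayer w b k).indicator 1) x with hF
  have hneg : ∀ j : ℕ, F (k₀ + 1 + -((j : ℤ) + 1)) ≤ b ^ k₀ * (2⁻¹) ^ j := by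
    intro j
    calc F (k₀ + 1 + -((j : ℤ) + 1)) ≤ b ^ (k₀ + 1 + -((j : ℤ) + 1)) * 1 := by
          simp only [hF]; gcongr; exact hlM_indicator_one_le_one _ _
      _ = b ^ k₀ * (b⁻¹) ^ j := by
          rw [mul_one, show k₀ + 1 + -((j : ℤ) + 1) = k₀ + -(j : ℤ) by ring,
            ENNReal.zpow_add hb0 hbfin, ENNReal.zpow_neg, zpow_natCast, ENNReal.inv_pow]
      _ ≤ _ := by gcongr
  have hpos : ∀ j : ℕ, F (k₀ + 1 + j) ≤ (1 - (2 * K)⁻¹) ^ j * (K * w x) := by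
    intro j
    simp only [hF]
    rw [mul_comm, ← ENNReal.le_div_iff_mul_le (Or.inl (ENNReal.zpow_pos hb0 hbfin _).ne')
      (Or.inl (ENNReal.zpow_ne_top hb0 hbfin _))]
    refine hlM_le_of_forall_closedBall fun c r hr hxc => ?_
    have hEm : MeasurableSet (levelLayer w b (k₀ + 1 + j)) := hw measurableSet_Ioc
    rw [lintegral_indicator_one hEm, Measure.restrict_apply hEm, Set.inter_comm]
    set β := Metric.closedBall c r
    have havg : volume.withDensity w β ≤ K * w x * volume β := by
      rw [withDensity_apply']
      exact (setLIntegral_closedBall_le_hlM_mul w hr hxc).trans (by gcongr)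
    have hdec := withDensity_levelSet_le hw hA hK hK0 c hr (l := b ^ (k₀ + 1))
      (ENNReal.zpow_pos hb0 hbfin _).ne' (ENNReal.zpow_ne_top hb0 hbfin _)
      (havg.trans (by gcongr)) j
    rw [← hb, ← zpow_natCast, ← ENNReal.zpow_add hb0 hbfin, add_comm (j : ℤ)] at hdec
    rw [mul_comm, ← mul_div_assoc, ENNReal.le_div_iff_mul_le
      (Or.inl (ENNReal.zpow_pos hb0 hbfin _).ne') (Or.inl (ENNReal.zpow_ne_top hb0 hbfin _))]
    calc volume (β ∩ levelLayer w b (k₀ + 1 + j)) * b ^ (k₀ + 1 + j : ℤ)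
        = ∫⁻ _ in β ∩ levelLayer w b (k₀ + 1 + j), b ^ (k₀ + 1 + j : ℤ) := by
          rw [setLIntegral_const, mul_comm]
      _ ≤ ∫⁻ y in β ∩ levelLayer w b (k₀ + 1 + j), w y :=
          setLIntegral_mono' (measurableSet_closedBall.inter hEm) fun y hy => hy.2.1.le
      _ = volume.withDensity w (β ∩ levelLayer w b (k₀ + 1 + j)) :=
          (withDensity_apply' _ _).symm
      _ ≤ volume.withDensity w (β ∩ {y | b ^ (k₀ + 1 + j : ℤ) < w y}) :=
          measure_mono (Set.inter_subset_inter_right _ fun y hy => hy.1)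
      _ ≤ (1 - (2 * K)⁻¹) ^ j * (K * w x * volume β) := hdec.trans (by gcongr)
      _ = volume β * ((1 - (2 * K)⁻¹) ^ j * (K * w x)) := by ring
  have h2K : (2 * K)⁻¹ ≤ 1 := by
    rw [ENNReal.inv_le_one]
    exact hK1.trans (by rw [two_mul]; exact le_self_add)
  calc ∑' k : ℤ, F k = ∑' k : ℤ, F (k₀ + 1 + k) := ((Equiv.addLeft (k₀ + 1)).tsum_eq F).symm
    _ = ∑' j : ℕ, F (k₀ + 1 + j) + ∑' j : ℕ, F (k₀ + 1 + -((j : ℤ) + 1)) :=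
        (HasSum.of_nat_of_neg_add_one (f := fun k : ℤ => F (k₀ + 1 + k))
          ENNReal.summable.hasSum ENNReal.summable.hasSum).tsum_eq
    _ ≤ ∑' j : ℕ, (1 - (2 * K)⁻¹) ^ j * (K * w x) + ∑' j : ℕ, b ^ k₀ * (2⁻¹) ^ j :=
        add_le_add (ENNReal.tsum_le_tsum hpos) (ENNReal.tsum_le_tsum hneg)
    _ = 2 * K * (K * w x) + b ^ k₀ * 2 := by
        rw [ENNReal.tsum_mul_right, ENNReal.tsum_mul_left, ENNReal.tsum_geometric,
          ENNReal.tsum_geometric, ENNReal.sub_sub_cancel ENNReal.one_ne_top h2K, inv_inv,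
          ENNReal.one_sub_inv_two, inv_inv]
    _ ≤ 2 * K * (K * w x) + (K * (K * w x)) * 2 := by
        gcongr
        calc b ^ k₀ ≤ K * w x := hk₀.le
          _ = 1 * (K * w x) := (one_mul _).symm
          _ ≤ _ := by gcongr
    _ = _ := by ring

lemma tsum_lintegral_le_lintegral_tsum {α ι : Type*} [MeasurableSpace α] (μ : Measure α)
    (F : ι → α → ℝ≥0∞) : ∑' i, ∫⁻ x, F i x ∂μ ≤ ∫⁻ x, ∑' i, F i x ∂μ := by
  classical
  rw [ENNReal.tsum_eq_iSup_sum]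
  refine iSup_le fun s => le_trans ?_
    (lintegral_mono fun x => ENNReal.sum_le_tsum (f := fun i => F i x) s)
  induction s using Finset.induction_on with
  | empty => simp
  | insert i s hi ih =>
    simp only [Finset.sum_insert hi]
    exact (add_le_add_right ih _).trans (le_lintegral_add _ _)

/-- The mixed weak type inequality for a measurable `A₁` weight with values in `ℝ≥0∞`. -/
theorem mixed_weak_type (hw : Measurable w) (hA : ∀ᵐ x, hlM w x ≤ K * w x)
    (hK : K ≠ ∞) (hK1 : 1 ≤ K) (hw0 : ∀ᵐ x, w x ≠ 0) (hw1 : ∀ᵐ x, w x ≠ ∞)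
    {g : (Fin n → ℝ) → ℝ≥0∞} (hg : Measurable g) (t : ℝ≥0∞) :
    t * ∫⁻ x in {x | t < hlM g x / w x}, w x * w x ≤
      (2 * 2 ^ n) ^ 2 * 5 ^ n * 4 * K ^ 2 * ∫⁻ x, g x * w x := by
  set b : ℝ≥0∞ := 2 * 2 ^ n with hb
  have hb2 : 2 ≤ b := by
    calc (2 : ℝ≥0∞) = 2 * 1 := (mul_one _).symm
      _ ≤ b := by rw [hb]; gcongr; exact one_le_pow_of_one_le' one_le_two n
  have hbfin : b ≠ ∞ := ENNReal.mul_ne_top (by simp) (by simp)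
  have hb0 : b ≠ 0 := (two_pos.trans_le hb2).ne'
  set ρ := volume.withDensity (fun x => w x * w x) with hρ
  have hac : ρ ≪ volume := withDensity_absolutelyContinuous _ _
  let G : ℕ → Set (Fin n → ℝ) := fun R => {x | (w x ≠ 0 ∧ w x ≠ ∞) ∧
    ∃ (c : Fin n → ℝ) (r : ℝ), 0 < r ∧ r ≤ R ∧ x ∈ Metric.closedBall c r ∧
      t * w x * volume (Metric.closedBall c r) < ∫⁻ y in Metric.closedBall c r, g y}
  have hGmono : Monotone G := by
    rintro R R' hRR' x ⟨hx, c, r, hr, hrR, h⟩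
    exact ⟨hx, c, r, hr, hrR.trans (by exact_mod_cast hRR'), h⟩
  have hsub : ρ {x | t < hlM g x / w x} ≤ ρ (⋃ R, G R) := by
    refine measure_mono_ae (hac.ae_le ?_)
    filter_upwards [hw0, hw1] with x hx0 hx1 hx
    obtain ⟨c, r, hr, hxc, hlt⟩ := exists_closedBall_of_lt_hlM (ENNReal.mul_lt_of_lt_div hx)
    obtain ⟨R, hR⟩ := exists_nat_ge r
    exact Set.mem_iUnion.2 ⟨R, ⟨hx0, hx1⟩, c, r, hr, hR, hxc, hlt⟩
  rw [← withDensity_apply' (fun x => w x * w x), ← hρ]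
  have hE : ∀ k, MeasurableSet (levelLayer w b k) := fun k => hw measurableSet_Ioc
  have hlayer : ∀ (R : ℕ) (k : ℤ), t * ρ (G R ∩ levelLayer w b k) ≤
      b ^ 2 * 5 ^ n * ∫⁻ x, g x * (b ^ k * hlM ((levelLayer w b k).indicator 1) x) := by
    intro R k
    have hbk : b ^ k ≠ ∞ := ENNReal.zpow_ne_top hb0 hbfin _
    have h1 : ρ (G R ∩ levelLayer w b k) ≤
        b ^ (k + 1) * b ^ (k + 1) * volume (G R ∩ levelLayer w b k) := by
      rw [hρ, withDensity_apply', ← setLIntegral_const]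
      refine lintegral_mono_ae (ae_restrict_of_ae_restrict_of_subset Set.inter_subset_right ?_)
      exact ae_restrict_of_forall_mem (hE k) fun x hx => mul_le_mul' hx.2 hx.2
    have h2 := mul_volume_le_lintegral_mul_hlM hg (hE k) R (t * b ^ k)
    have h3 : t * b ^ k * volume (G R ∩ levelLayer w b k) ≤
        5 ^ n * ∫⁻ x, g x * hlM ((levelLayer w b k).indicator 1) x := by
      refine le_trans ?_ h2
      gcongr
      rintro x ⟨⟨-, c, r, hr, hrR, hx, hlt⟩, hxE⟩
      refine ⟨hxE, c, r, hr, hrR, hx, lt_of_le_of_lt ?_ hlt⟩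
      gcongr
      exact hxE.1.le
    calc t * ρ (G R ∩ levelLayer w b k)
        ≤ t * (b ^ (k + 1) * b ^ (k + 1) * volume (G R ∩ levelLayer w b k)) := by gcongr
      _ = b ^ 2 * b ^ k * (t * b ^ k * volume (G R ∩ levelLayer w b k)) := by
          rw [ENNReal.zpow_add hb0 hbfin, zpow_one]; ring
      _ ≤ b ^ 2 * b ^ k * (5 ^ n * ∫⁻ x, g x * hlM ((levelLayer w b k).indicator 1) x) := by
          gcongr
      _ = b ^ 2 * 5 ^ n * (b ^ k * ∫⁻ x, g x * hlM ((levelLayer w b k).indicator 1) x) := by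
          ring
      _ = _ := by
          rw [← lintegral_const_mul' _ _ hbk]
          congr 2
          funext x
          ring
  have hGR : ∀ R, t * ρ (G R) ≤ b ^ 2 * 5 ^ n * 4 * K ^ 2 * ∫⁻ x, g x * w x := by
    intro R
    have hcov : G R ⊆ ⋃ k : ℤ, G R ∩ levelLayer w b k := by
      intro x hx
      obtain ⟨k, hk⟩ := ENNReal.exists_mem_Ioc_zpow hx.1.1 hx.1.2 (ENNReal.one_lt_two.trans_le hb2) hbfin
      exact Set.mem_iUnion.2 ⟨k, hx, hk⟩
    calc t * ρ (G R) ≤ t * ∑' k : ℤ, ρ (G R ∩ levelLayer w b k) := by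
          gcongr
          exact (measure_mono hcov).trans (measure_iUnion_le _)
      _ = ∑' k : ℤ, t * ρ (G R ∩ levelLayer w b k) := ENNReal.tsum_mul_left.symm
      _ ≤ ∑' k : ℤ, b ^ 2 * 5 ^ n *
            ∫⁻ x, g x * (b ^ k * hlM ((levelLayer w b k).indicator 1) x) :=
          ENNReal.tsum_le_tsum fun k => hlayer R k
      _ ≤ b ^ 2 * 5 ^ n *
            ∫⁻ x, ∑' k : ℤ, g x * (b ^ k * hlM ((levelLayer w b k).indicator 1) x) := by
          rw [ENNReal.tsum_mul_left]
          gcongr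
          exact tsum_lintegral_le_lintegral_tsum _ _
      _ ≤ b ^ 2 * 5 ^ n * ∫⁻ x, 4 * K ^ 2 * (g x * w x) := by
          gcongr b ^ 2 * 5 ^ n * ?_
          refine lintegral_mono_ae ?_
          filter_upwards [hA, hw0, hw1] with x hx hx0 hx1
          rw [ENNReal.tsum_mul_left]
          calc _ ≤ g x * (4 * K ^ 2 * w x) := by
                gcongr
                exact tsum_zpow_mul_hlM_levelLayer_le hw hA hK hK1 hx hx0 hx1
            _ = _ := by ring
      _ = _ := by
          rw [lintegral_const_mul (4 * K ^ 2) (f := fun x => g x * w x) (hg.mul hw)]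
          ring
  calc t * ρ {x | t < hlM g x / w x} ≤ t * ρ (⋃ R, G R) := by gcongr
    _ = ⨆ R, t * ρ (G R) := by rw [hGmono.measure_iUnion, ENNReal.mul_iSup]
    _ ≤ _ := iSup_le hGR

end WeakType

lemma one_le_of_hlM_le {n : ℕ} {w : (Fin n → ℝ) → ℝ≥0∞} {K : ℝ≥0∞} (hw : Measurable w)
    (hA : ∀ᵐ x, hlM w x ≤ K * w x) (hw0 : ∀ᵐ x, w x ≠ 0) (hw1 : ∀ᵐ x, w x ≠ ∞) : 1 ≤ K := by
  rcases eq_or_ne K ∞ with rfl | hK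
  · exact le_top
  set B : Set (Fin n → ℝ) := Metric.closedBall 0 1
  have hpos : volume B ≠ 0 := (Metric.measure_closedBall_pos _ _ one_pos).ne'
  have hfin : volume B ≠ ∞ := measure_closedBall_lt_top.ne
  have hB0 : ∫⁻ x in B, w x ≠ 0 := by
    rw [Ne, lintegral_eq_zero_iff hw]
    intro h
    have hfalse : ∀ᵐ x ∂volume.restrict B, False := by
      filter_upwards [h, ae_restrict_of_ae hw0] with x hx hx0
      exact hx0 hx
    rw [eventually_false_iff_eq_bot, ae_eq_bot, Measure.restrict_eq_zero] at hfalse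
    exact hpos hfalse
  have hB1 : ∫⁻ x in B, w x ≠ ∞ := by
    have hbound : ∀ᵐ x ∂volume.restrict B, ∫⁻ y in B, w y ≠ ∞ := by
      refine (ae_restrict_iff' measurableSet_closedBall).2 ?_
      filter_upwards [hA, hw1] with x hx hx1 hxB
      refine ne_top_of_le_ne_top (ENNReal.mul_ne_top (ENNReal.mul_ne_top hK hx1) hfin)
        ((setLIntegral_closedBall_le_hlM_mul w one_pos hxB).trans ?_)
      gcongr
    have : NeBot (ae (volume.restrict B)) := by
      rw [ae_neBot, Ne, Measure.restrict_eq_zero]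
      exact hpos
    exact hbound.exists.choose_spec
  have h := withDensity_closedBall_mul_le hw hA 0 one_pos
    (subset_rfl : B ⊆ B) measurableSet_closedBall
  rw [withDensity_apply', mul_assoc] at h
  refine (ENNReal.mul_le_mul_iff_left (mul_ne_zero hB0 hpos) (ENNReal.mul_ne_top hB1 hfin)).1 ?_
  rwa [one_mul]

/-- **Sharp bound in the case `u = v ∈ A₁`.**
`‖M(fu)/u‖_{L^{1,∞}(u²)} ≤ c_n [u]_{A₁}² ‖f‖_{L¹(u²)}`. -/
theorem quantitative_bound_u_equals_v (n : ℕ) :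
    ∃ c : ℝ≥0, 0 < c ∧
      ∀ u : (Fin n → ℝ) → ℝ, IsWeight u → a1Const u ≠ ∞ →
        ∀ f : (Fin n → ℝ) → ℝ, Measurable f →
          l1Norm f (fun x => u x * u x) ≠ ∞ →
          wkNorm (fun x => hlMR (fun y => f y * u y) x / ENNReal.ofReal (u x))
              (fun x => u x * u x) ≤
            (c : ℝ≥0∞) * a1Const u ^ 2 * l1Norm f (fun x => u x * u x) := by
  refine ⟨(2 * 2 ^ n) ^ 2 * 5 ^ n * 4, by positivity, fun u hu hK f hf _ => ?_⟩
  have hum : AEMeasurable (fun y => ENNReal.ofReal (u y)) volume :=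
    hu.1.aestronglyMeasurable.aemeasurable.ennreal_ofReal
  set w := hum.mk with hwdef
  have hw : Measurable w := hum.measurable_mk
  have hwu : (fun y => ENNReal.ofReal (u y)) =ᵐ[volume] w := hum.ae_eq_mk
  have hw0 : ∀ᵐ x, w x ≠ 0 := by
    filter_upwards [hwu, hu.2] with x hx hx0
    rw [← hx, Ne, ENNReal.ofReal_eq_zero, not_le]
    exact hx0
  have hw1 : ∀ᵐ x, w x ≠ ∞ := by
    filter_upwards [hwu] with x hx
    rw [← hx]
    exact ENNReal.ofReal_ne_top
  have hA : ∀ᵐ x, hlM w x ≤ a1Const u * w x := by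
    rw [← hlM_congr_ae hwu]
    filter_upwards [hwu, hw0, hw1, ENNReal.ae_le_essSup
      (fun x => hlM (fun y => ENNReal.ofReal (u y)) x / ENNReal.ofReal (u x))]
      with x hx hx0 hx1 hle
    rw [hx] at hle
    exact (ENNReal.div_le_iff hx0 hx1).1 hle
  have hK1 : 1 ≤ a1Const u := one_le_of_hlM_le hw hA hw0 hw1
  have hgu : (fun y => ENNReal.ofReal |f y * u y|) =ᵐ[volume]
      fun y => ENNReal.ofReal |f y| * w y := by
    filter_upwards [hwu, hu.2] with x hx hx0
    rw [abs_mul, ENNReal.ofReal_mul (abs_nonneg _), abs_of_pos hx0, hx]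
  have hu2 : (fun x => ENNReal.ofReal (u x * u x)) =ᵐ[volume] fun x => w x * w x := by
    filter_upwards [hwu, hu.2] with x hx hx0
    rw [ENNReal.ofReal_mul hx0.le, hx]
  have hg : Measurable fun y => ENNReal.ofReal |f y| * w y :=
    (hf.norm.ennreal_ofReal).mul hw
  have hnorm : l1Norm f (fun x => u x * u x) =
      ∫⁻ x, ENNReal.ofReal |f x| * w x * w x := by
    refine lintegral_congr_ae ?_
    filter_upwards [hu2] with x hx
    rw [hx, mul_assoc]
  rw [hnorm]
  refine iSup₂_le fun t _ => ?_
  have hset : {x | (t : ℝ≥0∞) < hlMR (fun y => f y * u y) x / ENNReal.ofReal (u x)} =ᵐ[volume]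
      {x | (t : ℝ≥0∞) < hlM (fun y => ENNReal.ofReal |f y| * w y) x / w x} := by
    rw [hlMR, hlM_congr_ae hgu]
    filter_upwards [hwu] with x hx
    exact congrArg (fun s => (t : ℝ≥0∞) <
      hlM (fun y => ENNReal.ofReal |f y| * w y) x / s) hx
  rw [wMeas, Measure.restrict_congr_set hset, lintegral_congr_ae (ae_restrict_of_ae hu2)]
  have := mixed_weak_type hw hA hK hK1 hw0 hw1 hg t
  push_cast
  exact this
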